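/- Let G be a finite group, θ : G → G an involutive automorphism, and H ⊆ G a θ-stable subgroup (θ(H) = H). If (G,H) is a Gelfand pair and every H-distinguished irreducible complex representation π of G satisfies π ∘ θ ≅ π*, then for every g ∈ G there exist h₁, h₂ ∈ H such that h₁ g⁻¹ h₂ = θ(g). -/

import Mathlib

open scoped Classical TensorProduct

noncomputable section

namespace GK

variable {G : Type} [Group G]

/-- A complex representation is irreducible if it is nonzero and has no invariant subspaces
other than `⊥` and `⊤`. -/
def IsIrred {V : Type} [AddCommGroup V] [Module ℂ V] (π : Representation ℂ G V) : Prop :=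
  (⊥ : Submodule ℂ V) ≠ ⊤ ∧
    ∀ W : Submodule ℂ V, (∀ (g : G), ∀ v ∈ W, π g v ∈ W) → W = ⊥ ∨ W = ⊤

/-- The subspace `π^H` of vectors invariant under a subgroup `H`. -/
def invariantsOf {V : Type} [AddCommGroup V] [Module ℂ V] (π : Representation ℂ G V)
    (H : Subgroup G) : Submodule ℂ V where
  carrier := {v | ∀ h ∈ H, π h v = v}
  add_mem' := by
    intro a b ha hb h hh
    simp [map_add, ha h hh, hb h hh]
  zero_mem' := by
    intro h hh
    simp
  smul_mem' := by
    intro c v hv h hh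
    simp [map_smul, hv h hh]

/-- `(G, H)` is a Gelfand pair: every irreducible complex representation of `G` has at most
one-dimensional space of `H`-invariant vectors. -/
def IsGelfandPair (G : Type) [Group G] (H : Subgroup G) : Prop :=
  ∀ (V : Type) [AddCommGroup V] [Module ℂ V] [FiniteDimensional ℂ V]
    (π : Representation ℂ G V), IsIrred π →
      Module.finrank ℂ (invariantsOf π H) ≤ 1

/-- Isomorphism of representations. -/
def RepIso {V W : Type} [AddCommGroup V] [Module ℂ V] [AddCommGroup W] [Module ℂ W]
    (π : Representation ℂ G V) (τ : Representation ℂ G W) : Prop :=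
  ∃ e : V ≃ₗ[ℂ] W, ∀ (g : G) (v : V), e (π g v) = τ g (e v)

/-- `π ∘ θ ≅ π*`: the θ-twist of `π` is isomorphic to the dual (contragredient)
representation of `π`. -/
def ConjThetaIsoDual {V : Type} [AddCommGroup V] [Module ℂ V] (θ : G ≃* G)
    (π : Representation ℂ G V) : Prop :=
  RepIso (MonoidHom.comp π θ.toMonoidHom) π.dual

/-- `π` possesses a nonzero symmetric bilinear form `B` with
`B(π(g)v, w) = B(v, π(θ(g⁻¹))w)`. -/
def HasSymForm {V : Type} [AddCommGroup V] [Module ℂ V] (θ : G ≃* G)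
    (π : Representation ℂ G V) : Prop :=
  ∃ B : V →ₗ[ℂ] V →ₗ[ℂ] ℂ, B ≠ 0 ∧ (∀ v w, B v w = B w v) ∧
    ∀ (g : G) (v w : V), B (π g v) w = B v (π (θ g⁻¹) w)

/-- `π` possesses a nonzero antisymmetric bilinear form `B` with
`B(π(g)v, w) = B(v, π(θ(g⁻¹))w)`. -/
def HasAltForm {V : Type} [AddCommGroup V] [Module ℂ V] (θ : G ≃* G)
    (π : Representation ℂ G V) : Prop :=
  ∃ B : V →ₗ[ℂ] V →ₗ[ℂ] ℂ, B ≠ 0 ∧ (∀ v w, B v w = - B w v) ∧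
    ∀ (g : G) (v w : V), B (π g v) w = B v (π (θ g⁻¹) w)

/-- The twisted Frobenius–Schur indicator `ε_θ(π)`: `1` if `π` has a nonzero symmetric
θ-twisted invariant bilinear form, `-1` if it has a nonzero antisymmetric one, and `0`
otherwise (for irreducible `π` this last case is exactly `π ∘ θ ≇ π*`). -/
def eps {V : Type} [AddCommGroup V] [Module ℂ V] (θ : G ≃* G)
    (π : Representation ℂ G V) : ℤ :=
  if HasSymForm θ π then 1 else if HasAltForm θ π then -1 else 0

end GK

namespace GK

variable {G : Type} [Group G] {V : Type} [AddCommGroup V] [Module ℂ V]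

/-- A simple left ideal of the group algebra is an irreducible representation. -/
lemma isIrred_ofModule' (S : Submodule (MonoidAlgebra ℂ G) (MonoidAlgebra ℂ G))
    [hS : IsSimpleModule (MonoidAlgebra ℂ G) S] :
    IsIrred (Representation.ofModule' (k := ℂ) (G := G) S) := by
  refine ⟨?_, fun W hW => ?_⟩
  · have := IsSimpleModule.nontrivial (MonoidAlgebra ℂ G) S
    exact bot_ne_top
  · have hW' : ∀ (g : G) (v : S), v ∈ W → MonoidAlgebra.of ℂ G g • v ∈ W := fun g v hv => by
      simpa [Representation.ofModule'] using hW g v hv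
    rcases eq_bot_or_eq_top (MonoidAlgebra.submoduleOfSMulMem W hW') with h | h
    · refine Or.inl (eq_bot_iff.mpr fun x hx => ?_)
      have : x ∈ MonoidAlgebra.submoduleOfSMulMem W hW' := hx
      simpa [h] using this
    · refine Or.inr (eq_top_iff.mpr fun x _ => ?_)
      have : x ∈ MonoidAlgebra.submoduleOfSMulMem W hW' := by simp [h]
      exact this

variable [Fintype G]

/-- The unnormalized averaging operator `∑ h ∈ H, π h`. -/
def sumOver (π : Representation ℂ G V) (H : Subgroup G) : V →ₗ[ℂ] V :=
  ∑ h : H, π h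

lemma sumOver_apply (π : Representation ℂ G V) (H : Subgroup G) (v : V) :
    sumOver π H v = ∑ h : H, π h v := by
  simp [sumOver]

lemma sumOver_mem_invariantsOf (π : Representation ℂ G V) (H : Subgroup G) (v : V) :
    sumOver π H v ∈ invariantsOf π H := by
  intro h hh
  simp only [sumOver_apply, map_sum]
  refine Fintype.sum_equiv (Equiv.mulLeft (⟨h, hh⟩ : H)) _ _ fun k => ?_
  simp

/-- An `H`-invariant functional is multiplied by `|H|` under averaging. -/
lemma apply_sumOver (π : Representation ℂ G V) (H : Subgroup G) (f : V →ₗ[ℂ] ℂ)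
    (hf : ∀ h ∈ H, ∀ v, f (π h v) = f v) (v : V) :
    f (sumOver π H v) = Fintype.card H * f v := by
  simp [sumOver_apply, hf]

/-- On an irreducible representation with at most one-dimensional `H`-invariants, which is
`θ`-self-dual if it is `H`-distinguished, the elements `g` and `θ g⁻¹` have the same
compression to the `H`-invariants. -/
lemma sumOver_comp_eq [FiniteDimensional ℂ V] (θ : G ≃* G) (hθ : ∀ g : G, θ (θ g) = g)
    (H : Subgroup G) (hH : ∀ h ∈ H, θ h ∈ H) (π : Representation ℂ G V)
    (hdim : Module.finrank ℂ (invariantsOf π H) ≤ 1)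
    (hsd : invariantsOf π H ≠ ⊥ → ConjThetaIsoDual θ π) (g : G) (w : V) :
    sumOver π H (π g (sumOver π H w)) = sumOver π H (π (θ g⁻¹) (sumOver π H w)) := by
  set v := sumOver π H w with hv
  have hvH : v ∈ invariantsOf π H := sumOver_mem_invariantsOf π H w
  rcases eq_or_ne v 0 with h0 | h0
  · simp [h0]
  obtain ⟨e, he⟩ := hsd fun h => h0 (by simpa [h] using hvH)
  have hB (a : G) (x y : V) : e (π (θ a) x) y = e x (π a⁻¹ y) := by
    have := he a x
    simpa using! LinearMap.congr_fun this y
  have hspan (x : V) : ∃ c : ℂ, sumOver π H x = c • v := by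
    obtain ⟨u, hu⟩ := finrank_le_one_iff.mp hdim
    obtain ⟨a, ha⟩ := hu ⟨v, hvH⟩
    obtain ⟨b, hb⟩ := hu ⟨_, sumOver_mem_invariantsOf π H x⟩
    have ha' : a • (u : V) = v := congrArg Subtype.val ha
    have hb' : b • (u : V) = sumOver π H x := congrArg Subtype.val hb
    have ha0 : a ≠ 0 := by
      rintro rfl
      exact h0 (by simpa using ha'.symm)
    exact ⟨b / a, by rw [← ha', ← hb', smul_smul, div_mul_cancel₀ _ ha0]⟩
  have hright : ∀ h ∈ H, ∀ x, e v (π h x) = e v x := fun h hh x => by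
    rw [← inv_inv h, ← hB, hvH _ (hH _ (H.inv_mem hh))]
  have hleft : ∀ h ∈ H, ∀ x, e (π h x) v = e x v := fun h hh x => by
    rw [← hθ h, hB, hvH _ (H.inv_mem (hH _ hh))]
  have hN : (Fintype.card H : ℂ) ≠ 0 := Nat.cast_ne_zero.mpr Fintype.card_ne_zero
  have hvv : e v v ≠ 0 := by
    intro h
    refine h0 (e.map_eq_zero_iff.mp (LinearMap.ext fun x => ?_))
    obtain ⟨c, hc⟩ := hspan x
    have := apply_sumOver π H (e v) hright x
    rw [hc, map_smul, h, smul_zero] at this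
    simpa [hN] using this.symm
  obtain ⟨c, hc⟩ := hspan (π g v)
  obtain ⟨d, hd⟩ := hspan (π (θ g⁻¹) v)
  have h1 := apply_sumOver π H (e v) hright (π g v)
  have h2 := apply_sumOver π H (e.toLinearMap.flip v) hleft (π (θ g⁻¹) v)
  simp only [LinearMap.flip_apply, LinearEquiv.coe_coe] at h2
  rw [hc, map_smul] at h1
  rw [hd, map_smul, LinearMap.smul_apply, hB, inv_inv, ← h1] at h2
  rw [hc, hd, mul_right_cancel₀ hvv h2]

/-- An element of the group algebra of a finite group is zero if it kills every simple left
ideal. -/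
lemma eq_zero_of_forall_simple (T : MonoidAlgebra ℂ G)
    (hT : ∀ S : Submodule (MonoidAlgebra ℂ G) (MonoidAlgebra ℂ G),
      IsSimpleModule (MonoidAlgebra ℂ G) S → ∀ x ∈ S, T * x = 0) : T = 0 := by
  have h1 : (1 : MonoidAlgebra ℂ G) ∈ sSup {S : Submodule (MonoidAlgebra ℂ G)
      (MonoidAlgebra ℂ G) | IsSimpleModule (MonoidAlgebra ℂ G) S} := by
    rw [IsSemisimpleModule.sSup_simples_eq_top]
    trivial
  rw [sSup_eq_iSup'] at h1
  rw [← mul_one T]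
  exact Submodule.iSup_induction (motive := fun x => T * x = 0) _ h1
    (fun S x hx => hT S S.2 x hx) (mul_zero T)
    fun x y hx hy => by rw [mul_add, hx, hy, add_zero]

/-- The sum of `h * g * k` over `h, k ∈ H` in the group algebra. -/
def doubleCosetSum (H : Subgroup G) (g : G) : MonoidAlgebra ℂ G :=
  ∑ h : H, ∑ k : H, MonoidAlgebra.single ((h : G) * g * k) 1

lemma doubleCosetSum_coeff (H : Subgroup G) (g x : G) :
    (doubleCosetSum H g).coeff x =
      ((Finset.univ.filter fun p : H × H => (p.1 : G) * g * p.2 = x).card : ℂ) := by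
  rw [doubleCosetSum, ← Fintype.sum_prod_type']
  simp [MonoidAlgebra.coeff_sum, Finsupp.single_apply]

/-- The element `doubleCosetSum H g` acts on a module as `g` compressed by averages over `H`. -/
lemma sumOver_ofModule' (H : Subgroup G) (g : G)
    (S : Submodule (MonoidAlgebra ℂ G) (MonoidAlgebra ℂ G)) (x : S) :
    (sumOver (Representation.ofModule' (k := ℂ) (G := G) S) H
      (Representation.ofModule' (k := ℂ) (G := G) S g
        (sumOver (Representation.ofModule' (k := ℂ) (G := G) S) H x)) : MonoidAlgebra ℂ G) =
      doubleCosetSum H g * x := by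
  simp only [sumOver_apply, map_sum, doubleCosetSum, Finset.sum_mul]
  rw [Finset.sum_comm]
  simp [Representation.ofModule', ← mul_assoc, MonoidAlgebra.single_mul_single]

end GK

/-- If `(G,H)` is a Gelfand pair and every `H`-distinguished irreducible
representation satisfies `π ∘ θ ≅ π*`, then the Gelfand–Kazhdan condition holds. -/
theorem GK_of_gelfand_and_selfdual {G : Type} [Group G] [Fintype G]
    (θ : G ≃* G) (hθ : ∀ g : G, θ (θ g) = g)
    (H : Subgroup G) (hH : H.map θ.toMonoidHom = H)
    (hGP : GK.IsGelfandPair G H)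
    (hsd : ∀ (V : Type) [AddCommGroup V] [Module ℂ V] [FiniteDimensional ℂ V]
        (π : Representation ℂ G V), GK.IsIrred π → GK.invariantsOf π H ≠ ⊥ →
          GK.ConjThetaIsoDual θ π) :
    ∀ g : G, ∃ h₁ ∈ H, ∃ h₂ ∈ H, h₁ * g⁻¹ * h₂ = θ g := by
  have hH' : ∀ h ∈ H, θ h ∈ H := fun h hh => by
    rw [← hH]
    exact ⟨h, hh, rfl⟩
  intro g
  have key : GK.doubleCosetSum H g - GK.doubleCosetSum H (θ g⁻¹) = 0 := by
    refine GK.eq_zero_of_forall_simple _ fun S hS x hx => ?_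
    have : FiniteDimensional ℂ (MonoidAlgebra ℂ G) :=
      Module.Finite.of_basis (MonoidAlgebra.basis G ℂ)
    have : FiniteDimensional ℂ S :=
      inferInstanceAs (FiniteDimensional ℂ (S.restrictScalars ℂ))
    have hirr := GK.isIrred_ofModule' S
    have h := GK.sumOver_comp_eq θ hθ H hH' _ (hGP S _ hirr) (hsd S _ hirr) g ⟨x, hx⟩
    rw [sub_mul, sub_eq_zero]
    simpa only [GK.sumOver_ofModule'] using congrArg Subtype.val h
  have hcoeff := congrArg (fun T => T.coeff g) (sub_eq_zero.mp key)
  simp only [GK.doubleCosetSum_coeff, Nat.cast_inj] at hcoeff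
  have hpos : 0 < (Finset.univ.filter fun p : H × H => (p.1 : G) * g * p.2 = g).card :=
    Finset.card_pos.mpr ⟨1, by simp⟩
  rw [hcoeff, Finset.card_pos] at hpos
  obtain ⟨⟨h, k⟩, hp⟩ := hpos
  have hp' : (h : G) * θ g⁻¹ * k = g := by simpa using hp
  refine ⟨k, k.2, h, h.2, ?_⟩
  have hinv : ((h : G) * (θ g)⁻¹ * k)⁻¹ = g⁻¹ := by rw [← map_inv, hp']
  rw [← hinv]
  group
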